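/- arXiv:2306.03589 — 3 statements merged into one kernel-verified Lean document; each statement's English description precedes it below -/
import Mathlib

section
/- For an MPNN of depth m as specified, for all nodes v,u ∈ V and every input X, the d×d Jacobian matrix ∇_u h_v^{(m)} := ∂h_v^{(m)}/∂x_u satisfies the operator-norm bound ‖∇_u h_v^{(m)}‖ ≤ (c_σ w)^m (S^m)_{vu}. -/
open scoped BigOperators

noncomputable section

namespace OSQ

variable {n d : ℕ}

/-- componentwise application of the activation function. -/
def act (σ : ℝ → ℝ) (x : EuclideanSpace ℝ (Fin d)) : EuclideanSpace ℝ (Fin d) :=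
  WithLp.toLp 2 (fun i => σ (x i))

/-- node features computed by the MPNN after `t` layers. -/
def mpnn (σ : ℝ → ℝ) (𝒜 : Matrix (Fin n) (Fin n) ℝ)
    (Ω W : ℕ → EuclideanSpace ℝ (Fin d) →L[ℝ] EuclideanSpace ℝ (Fin d))
    (ψ : ℕ → EuclideanSpace ℝ (Fin d) × EuclideanSpace ℝ (Fin d) → EuclideanSpace ℝ (Fin d)) :
    ℕ → (Fin n → EuclideanSpace ℝ (Fin d)) → Fin n → EuclideanSpace ℝ (Fin d)
  | 0, X, v => X v
  | (t+1), X, v =>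
    act σ (Ω (t+1) (mpnn σ 𝒜 Ω W ψ t X v)
      + W (t+1) (∑ u : Fin n, 𝒜 v u • ψ (t+1) (mpnn σ 𝒜 Ω W ψ t X v, mpnn σ 𝒜 Ω W ψ t X u)))

/-- coordinate direction in the input space: a perturbation of entry `β` of the
feature of node `u`. -/
def dir (u : Fin n) (β : Fin d) : Fin n → EuclideanSpace ℝ (Fin d) :=
  Pi.single u (EuclideanSpace.single β 1)

/-- `∂ h_v^{(m),α} / ∂ x_u^β`. -/
def jacEntry (σ : ℝ → ℝ) (𝒜 : Matrix (Fin n) (Fin n) ℝ)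
    (Ω W : ℕ → EuclideanSpace ℝ (Fin d) →L[ℝ] EuclideanSpace ℝ (Fin d))
    (ψ : ℕ → EuclideanSpace ℝ (Fin d) × EuclideanSpace ℝ (Fin d) → EuclideanSpace ℝ (Fin d))
    (m : ℕ) (v u : Fin n) (X : Fin n → EuclideanSpace ℝ (Fin d)) (α β : Fin d) : ℝ :=
  fderiv ℝ (fun Y => mpnn σ 𝒜 Ω W ψ m Y v α) X (dir u β)

/-- `∂² h_i^{(m),α} / ∂ x_v^β ∂ x_u^γ`. -/
def hessEntry (σ : ℝ → ℝ) (𝒜 : Matrix (Fin n) (Fin n) ℝ)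
    (Ω W : ℕ → EuclideanSpace ℝ (Fin d) →L[ℝ] EuclideanSpace ℝ (Fin d))
    (ψ : ℕ → EuclideanSpace ℝ (Fin d) × EuclideanSpace ℝ (Fin d) → EuclideanSpace ℝ (Fin d))
    (m : ℕ) (i v u : Fin n) (X : Fin n → EuclideanSpace ℝ (Fin d)) (α β γ : Fin d) : ℝ :=
  fderiv ℝ (fun Y => fderiv ℝ (fun Z => mpnn σ 𝒜 Ω W ψ m Z i α) Y (dir u γ)) X (dir v β)

/-- graph-level prediction with SUM readout: `y(X) = θᵀ Σ_v h_v^{(m)}`. -/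
def readout (θ : EuclideanSpace ℝ (Fin d)) (σ : ℝ → ℝ) (𝒜 : Matrix (Fin n) (Fin n) ℝ)
    (Ω W : ℕ → EuclideanSpace ℝ (Fin d) →L[ℝ] EuclideanSpace ℝ (Fin d))
    (ψ : ℕ → EuclideanSpace ℝ (Fin d) × EuclideanSpace ℝ (Fin d) → EuclideanSpace ℝ (Fin d))
    (m : ℕ) (X : Fin n → EuclideanSpace ℝ (Fin d)) : ℝ :=
  ∑ α : Fin d, θ α * (∑ v : Fin n, mpnn σ 𝒜 Ω W ψ m X v) α

/-- `∂² y^{(m)} / ∂ x_v^α ∂ x_u^β`. -/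
def mixEntry (θ : EuclideanSpace ℝ (Fin d)) (σ : ℝ → ℝ) (𝒜 : Matrix (Fin n) (Fin n) ℝ)
    (Ω W : ℕ → EuclideanSpace ℝ (Fin d) →L[ℝ] EuclideanSpace ℝ (Fin d))
    (ψ : ℕ → EuclideanSpace ℝ (Fin d) × EuclideanSpace ℝ (Fin d) → EuclideanSpace ℝ (Fin d))
    (m : ℕ) (v u : Fin n) (X : Fin n → EuclideanSpace ℝ (Fin d)) (α β : Fin d) : ℝ :=
  fderiv ℝ (fun Y => fderiv ℝ (fun Z => readout θ σ 𝒜 Ω W ψ m Z) Y (dir u β)) X (dir v α)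

/-- the matrix `S := (ω/w)I + c₁ diag(𝒜 1) + c₂ 𝒜`. -/
def Smat (ω w c₁ c₂ : ℝ) (𝒜 : Matrix (Fin n) (Fin n) ℝ) : Matrix (Fin n) (Fin n) ℝ :=
  (ω / w) • (1 : Matrix (Fin n) (Fin n) ℝ)
    + c₁ • Matrix.diagonal (fun i => ∑ j, 𝒜 i j) + c₂ • 𝒜

/-- `diag(𝒜 1)` : the diagonal matrix of row sums. -/
def rowSumDiag (𝒜 : Matrix (Fin n) (Fin n) ℝ) : Matrix (Fin n) (Fin n) ℝ :=
  Matrix.diagonal (fun i => ∑ j, 𝒜 i j)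

/-- `diag(1ᵀ M)` : the diagonal matrix of column sums. -/
def colSumDiag (M : Matrix (Fin n) (Fin n) ℝ) : Matrix (Fin n) (Fin n) ℝ :=
  Matrix.diagonal (fun j => ∑ i, M i j)

/-- the operator (spectral) norm of a matrix, viewed as a linear map between
Euclidean spaces. -/
def matOpNorm {ι κ : Type*} [Fintype ι] [Fintype κ] [DecidableEq ι] (M : Matrix κ ι ℝ) : ℝ :=
  ‖LinearMap.toContinuousLinearMap (Matrix.toEuclideanLin M)‖

theorem act_bound {E : Type*} [NormedAddCommGroup E] [NormedSpace ℝ E]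
    (σ : ℝ → ℝ) (hσ : ContDiff ℝ 1 σ) (cσ : ℝ) (hσ' : ∀ x, |deriv σ x| ≤ cσ)
    (f : E → EuclideanSpace ℝ (Fin d)) (x : E) (hf : DifferentiableAt ℝ f x) :
    DifferentiableAt ℝ (fun y => act σ (f y)) x ∧
    ∀ e, ‖fderiv ℝ (fun y => act σ (f y)) x e‖ ≤ cσ * ‖fderiv ℝ f x e‖ := by
  have hc : ∀ i, HasFDerivAt (fun y => act σ (f y) i)
      (deriv σ (f x i) • ((EuclideanSpace.proj i : EuclideanSpace ℝ (Fin d) →L[ℝ] ℝ).comp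
        (fderiv ℝ f x))) x := by
    intro i
    have h1 : HasFDerivAt (fun y => f y i)
        ((EuclideanSpace.proj i : EuclideanSpace ℝ (Fin d) →L[ℝ] ℝ).comp (fderiv ℝ f x)) x :=
      (EuclideanSpace.proj i : EuclideanSpace ℝ (Fin d) →L[ℝ] ℝ).hasFDerivAt.comp x hf.hasFDerivAt
    have h2 : HasDerivAt σ (deriv σ (f x i)) (f x i) :=
      (hσ.differentiable one_ne_zero _).hasDerivAt
    exact h2.comp_hasFDerivAt x h1
  have hd : DifferentiableAt ℝ (fun y => act σ (f y)) x := by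
    rw [differentiableAt_euclidean]
    exact fun i => (hc i).differentiableAt
  refine ⟨hd, fun e => ?_⟩
  have hcσ : 0 ≤ cσ := (abs_nonneg _).trans (hσ' 0)
  have hi : ∀ i, (fderiv ℝ (fun y => act σ (f y)) x e) i
      = deriv σ (f x i) * (fderiv ℝ f x e) i := by
    intro i
    have h3 : HasFDerivAt (fun y => act σ (f y) i)
        ((EuclideanSpace.proj i : EuclideanSpace ℝ (Fin d) →L[ℝ] ℝ).comp
          (fderiv ℝ (fun y => act σ (f y)) x)) x :=
      (EuclideanSpace.proj i : EuclideanSpace ℝ (Fin d) →L[ℝ] ℝ).hasFDerivAt.comp x hd.hasFDerivAt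
    have h4 := congrArg (fun L => L e) (h3.unique (hc i))
    simpa using h4
  rw [EuclideanSpace.norm_eq, EuclideanSpace.norm_eq]
  refine Real.sqrt_le_iff.2 ⟨by positivity, ?_⟩
  rw [mul_pow, Real.sq_sqrt (by positivity), Finset.mul_sum]
  refine Finset.sum_le_sum fun i _ => ?_
  rw [hi, norm_mul, mul_pow]
  gcongr
  exact hσ' _

theorem psi_bound (φ : EuclideanSpace ℝ (Fin d) × EuclideanSpace ℝ (Fin d) → EuclideanSpace ℝ (Fin d))
    (hφ : ContDiff ℝ 1 φ) (c₁ c₂ : ℝ)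
    (h1 : ∀ x y, ‖fderiv ℝ (fun z => φ (z, y)) x‖ ≤ c₁)
    (h2 : ∀ x y, ‖fderiv ℝ (fun z => φ (x, z)) y‖ ≤ c₂)
    (p : EuclideanSpace ℝ (Fin d) × EuclideanSpace ℝ (Fin d)) (a b : EuclideanSpace ℝ (Fin d)) :
    ‖fderiv ℝ φ p (a, b)‖ ≤ c₁ * ‖a‖ + c₂ * ‖b‖ := by
  obtain ⟨x, y⟩ := p
  have hd : HasFDerivAt φ (fderiv ℝ φ (x, y)) (x, y) :=
    (hφ.differentiable one_ne_zero _).hasFDerivAt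
  have e1 : HasFDerivAt (fun z => φ (z, y)) _ x :=
    HasFDerivAt.comp x hd (hasFDerivAt_prodMk_left x y)
  have e2 : HasFDerivAt (fun z => φ (x, z)) _ y :=
    HasFDerivAt.comp y hd (hasFDerivAt_prodMk_right x y)
  have k1 := (fderiv ℝ (fun z => φ (z, y)) x).le_of_opNorm_le (h1 x y) a
  have k2 := (fderiv ℝ (fun z => φ (x, z)) y).le_of_opNorm_le (h2 x y) b
  rw [e1.fderiv] at k1
  rw [e2.fderiv] at k2
  have : fderiv ℝ φ (x, y) (a, b) = fderiv ℝ φ (x, y) (a, 0) + fderiv ℝ φ (x, y) (0, b) := by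
    rw [← map_add]; simp
  rw [this]
  refine (norm_add_le _ _).trans (add_le_add ?_ ?_)
  · simpa using k1
  · simpa using k2

theorem mpnn_bound
    (𝒜 : Matrix (Fin n) (Fin n) ℝ)
    (h𝒜 : ∀ a b, 0 ≤ 𝒜 a b)
    (σ : ℝ → ℝ) (hσ : ContDiff ℝ 1 σ) (cσ : ℝ) (hσ' : ∀ x, |deriv σ x| ≤ cσ)
    (Ω W : ℕ → EuclideanSpace ℝ (Fin d) →L[ℝ] EuclideanSpace ℝ (Fin d))
    (ω w : ℝ) (hw : 0 < w) (hΩ : ∀ t, ‖Ω t‖ ≤ ω) (hW : ∀ t, ‖W t‖ ≤ w)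
    (ψ : ℕ → EuclideanSpace ℝ (Fin d) × EuclideanSpace ℝ (Fin d) → EuclideanSpace ℝ (Fin d))
    (hψ : ∀ t, ContDiff ℝ 1 (ψ t)) (c₁ c₂ : ℝ)
    (hψ₁ : ∀ t x y, ‖fderiv ℝ (fun z => ψ t (z, y)) x‖ ≤ c₁)
    (hψ₂ : ∀ t x y, ‖fderiv ℝ (fun z => ψ t (x, z)) y‖ ≤ c₂)
    (X : Fin n → EuclideanSpace ℝ (Fin d)) (u : Fin n) (e : EuclideanSpace ℝ (Fin d)) (m : ℕ) :
    ∀ v, DifferentiableAt ℝ (fun Y => mpnn σ 𝒜 Ω W ψ m Y v) X ∧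
      ‖fderiv ℝ (fun Y => mpnn σ 𝒜 Ω W ψ m Y v) X (Pi.single u e)‖
        ≤ (cσ * w) ^ m * ((Smat ω w c₁ c₂ 𝒜) ^ m) v u * ‖e‖ := by
  have hcσ : 0 ≤ cσ := (abs_nonneg _).trans (hσ' 0)
  have hω : 0 ≤ ω := (norm_nonneg _).trans (hΩ 0)
  have hc₁ : 0 ≤ c₁ := (norm_nonneg _).trans (hψ₁ 0 0 0)
  have hc₂ : 0 ≤ c₂ := (norm_nonneg _).trans (hψ₂ 0 0 0)
  induction m with
  | zero =>
    intro v
    have h : HasFDerivAt (fun Y : Fin n → EuclideanSpace ℝ (Fin d) => Y v)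
      (ContinuousLinearMap.proj (R := ℝ) v) X := hasFDerivAt_apply v X
    simp only [mpnn]
    refine ⟨h.differentiableAt, ?_⟩
    rw [h.fderiv]
    by_cases hvu : v = u
    · subst hvu; simp
    · simp [hvu]
  | succ t ih =>
    intro v
    set h : Fin n → (Fin n → EuclideanSpace ℝ (Fin d)) → EuclideanSpace ℝ (Fin d) :=
      fun k Y => mpnn σ 𝒜 Ω W ψ t Y k with hh
    set D : Fin n → EuclideanSpace ℝ (Fin d) := fun k => fderiv ℝ (h k) X (Pi.single u e) with hD
    have hder : ∀ k, HasFDerivAt (h k) (fderiv ℝ (h k) X) X := fun k => (ih k).1.hasFDerivAt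
    have hp : ∀ k, HasFDerivAt (fun Y => ψ (t+1) (h v Y, h k Y))
        ((fderiv ℝ (ψ (t+1)) (h v X, h k X)).comp ((fderiv ℝ (h v) X).prod (fderiv ℝ (h k) X))) X := by
      intro k
      have hd : HasFDerivAt (ψ (t+1)) (fderiv ℝ (ψ (t+1)) (h v X, h k X)) (h v X, h k X) :=
        ((hψ (t+1)).differentiable one_ne_zero _).hasFDerivAt
      exact HasFDerivAt.comp X hd ((hder v).prodMk (hder k))
    have hs := HasFDerivAt.fun_sum (u := Finset.univ) (fun k _ => (hp k).const_smul (𝒜 v k))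
    have hpre := ((Ω (t+1)).hasFDerivAt.comp X (hder v)).add ((W (t+1)).hasFDerivAt.comp X hs)
    have hact := act_bound σ hσ cσ hσ' _ X hpre.differentiableAt
    refine ⟨hact.1, (hact.2 (Pi.single u e)).trans ?_⟩
    rw [hpre.fderiv]
    have hb : ∀ k, ‖D k‖ ≤ (cσ * w) ^ t * ((Smat ω w c₁ c₂ 𝒜) ^ t) k u * ‖e‖ := fun k => (ih k).2
    have hS : ((Smat ω w c₁ c₂ 𝒜) ^ (t+1)) v u
        = ω / w * ((Smat ω w c₁ c₂ 𝒜) ^ t) v u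
          + ∑ k, 𝒜 v k * (c₁ * ((Smat ω w c₁ c₂ 𝒜) ^ t) v u
            + c₂ * ((Smat ω w c₁ c₂ 𝒜) ^ t) k u) := by
      rw [pow_succ']
      generalize (Smat ω w c₁ c₂ 𝒜) ^ t = M
      simp only [Smat, add_mul, Matrix.add_apply, Matrix.smul_mul, Matrix.smul_apply, one_mul,
        smul_eq_mul, Matrix.diagonal_mul]
      rw [Matrix.mul_apply]
      simp only [mul_add, Finset.sum_add_distrib, Finset.mul_sum, Finset.sum_mul, add_assoc]
      congr 2
      · exact Finset.sum_congr rfl fun _ _ => by ring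
      · exact Finset.sum_congr rfl fun _ _ => by ring
    rw [hS]
    set M := (Smat ω w c₁ c₂ 𝒜) ^ t
    set C := (cσ * w) ^ t * ‖e‖ with hC
    have key : ‖Ω (t+1) (D v) + W (t+1) (∑ k, 𝒜 v k • fderiv ℝ (ψ (t+1)) (h v X, h k X) (D v, D k))‖
        ≤ ω * (C * M v u) + w * ∑ k, 𝒜 v k * (c₁ * (C * M v u) + c₂ * (C * M k u)) := by
      have hb' : ∀ k, ‖D k‖ ≤ C * M k u := fun k => (hb k).trans_eq (by rw [hC]; ring)
      refine (norm_add_le _ _).trans (add_le_add ?_ ?_)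
      · exact ((Ω (t+1)).le_of_opNorm_le (hΩ _) _).trans
          (mul_le_mul_of_nonneg_left (hb' v) hω)
      · refine ((W (t+1)).le_of_opNorm_le (hW _) _).trans
          (mul_le_mul_of_nonneg_left ?_ hw.le)
        refine (norm_sum_le _ _).trans (Finset.sum_le_sum fun k _ => ?_)
        rw [norm_smul, Real.norm_of_nonneg (h𝒜 v k)]
        refine mul_le_mul_of_nonneg_left ?_ (h𝒜 v k)
        refine (psi_bound _ (hψ (t+1)) c₁ c₂ (hψ₁ _) (hψ₂ _) _ _ _).trans ?_
        exact add_le_add (mul_le_mul_of_nonneg_left (hb' v) hc₁)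
          (mul_le_mul_of_nonneg_left (hb' k) hc₂)
    have hfin : cσ * (ω * (C * M v u) + w * ∑ k, 𝒜 v k * (c₁ * (C * M v u) + c₂ * (C * M k u)))
        = (cσ * w) ^ (t+1) * (ω / w * M v u + ∑ k, 𝒜 v k * (c₁ * M v u + c₂ * M k u)) * ‖e‖ := by
      have : ∑ k, 𝒜 v k * (c₁ * (C * M v u) + c₂ * (C * M k u))
          = C * ∑ k, 𝒜 v k * (c₁ * M v u + c₂ * M k u) := by
        rw [Finset.mul_sum]
        exact Finset.sum_congr rfl fun _ _ => by ring
      rw [this, hC, pow_succ]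
      field_simp
    rw [← hfin]
    refine mul_le_mul_of_nonneg_left (le_trans (le_of_eq ?_) key) hcσ
    simp [hD]

/-- Theorem B.1 / first-order sensitivity bound.
For an MPNN of depth `m`, `‖∇_u h_v^{(m)}‖ ≤ (c_σ w)^m (S^m)_{vu}`. -/
theorem jacobian_opNorm_bound
    (G : SimpleGraph (Fin n)) [DecidableRel G.Adj] (hconn : G.Connected)
    (𝒜 : Matrix (Fin n) (Fin n) ℝ)
    (h𝒜 : ∀ a b, (G.Adj a b → 0 < 𝒜 a b) ∧ (¬ G.Adj a b → 𝒜 a b = 0))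
    (σ : ℝ → ℝ) (hσ : ContDiff ℝ 1 σ) (cσ : ℝ) (hσ' : ∀ x, |deriv σ x| ≤ cσ)
    (Ω W : ℕ → EuclideanSpace ℝ (Fin d) →L[ℝ] EuclideanSpace ℝ (Fin d))
    (ω w : ℝ) (hw : 0 < w) (hΩ : ∀ t, ‖Ω t‖ ≤ ω) (hW : ∀ t, ‖W t‖ ≤ w)
    (ψ : ℕ → EuclideanSpace ℝ (Fin d) × EuclideanSpace ℝ (Fin d) → EuclideanSpace ℝ (Fin d))
    (hψ : ∀ t, ContDiff ℝ 1 (ψ t)) (c₁ c₂ : ℝ)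
    (hψ₁ : ∀ t x y, ‖fderiv ℝ (fun z => ψ t (z, y)) x‖ ≤ c₁)
    (hψ₂ : ∀ t x y, ‖fderiv ℝ (fun z => ψ t (x, z)) y‖ ≤ c₂)
    (m : ℕ) (v u : Fin n) (X : Fin n → EuclideanSpace ℝ (Fin d)) :
    OSQ.matOpNorm (Matrix.of fun α β => OSQ.jacEntry σ 𝒜 Ω W ψ m v u X α β)
      ≤ (cσ * w) ^ m * ((OSQ.Smat ω w c₁ c₂ 𝒜) ^ m) v u := by
  have h𝒜' : ∀ a b, 0 ≤ 𝒜 a b := by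
    intro a b
    by_cases h : G.Adj a b
    · exact ((h𝒜 a b).1 h).le
    · exact ((h𝒜 a b).2 h).ge
  have H := fun e => mpnn_bound 𝒜 h𝒜' σ hσ cσ hσ' Ω W ω w hw hΩ hW ψ hψ c₁ c₂ hψ₁ hψ₂ X u e m v
  have hd := (H 0).1
  have heq : ∀ e : EuclideanSpace ℝ (Fin d),
      Matrix.toEuclideanLin (Matrix.of fun α β => jacEntry σ 𝒜 Ω W ψ m v u X α β) e
        = fderiv ℝ (fun Y => mpnn σ 𝒜 Ω W ψ m Y v) X (Pi.single u e) := by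
    have hL : Matrix.toEuclideanLin (Matrix.of fun α β => jacEntry σ 𝒜 Ω W ψ m v u X α β)
        = (fderiv ℝ (fun Y => mpnn σ 𝒜 Ω W ψ m Y v) X).toLinearMap ∘ₗ
          LinearMap.single ℝ (fun _ : Fin n => EuclideanSpace ℝ (Fin d)) u := by
      refine (EuclideanSpace.basisFun (Fin d) ℝ).toBasis.ext fun β => ?_
      ext α
      have h3 : HasFDerivAt (fun Y => mpnn σ 𝒜 Ω W ψ m Y v α)
          ((EuclideanSpace.proj α : EuclideanSpace ℝ (Fin d) →L[ℝ] ℝ).comp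
            (fderiv ℝ (fun Y => mpnn σ 𝒜 Ω W ψ m Y v) X)) X :=
        (EuclideanSpace.proj α : EuclideanSpace ℝ (Fin d) →L[ℝ] ℝ).hasFDerivAt.comp X hd.hasFDerivAt
      simp [jacEntry, h3.fderiv, dir, Matrix.toLpLin_apply]
    intro e
    rw [hL]; rfl
  unfold matOpNorm
  have hcσ : 0 ≤ cσ := (abs_nonneg _).trans (hσ' 0)
  have hω : 0 ≤ ω := (norm_nonneg _).trans (hΩ 0)
  have hc₁ : 0 ≤ c₁ := (norm_nonneg _).trans (hψ₁ 0 0 0)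
  have hc₂ : 0 ≤ c₂ := (norm_nonneg _).trans (hψ₂ 0 0 0)
  have hS : ∀ a b, 0 ≤ Smat ω w c₁ c₂ 𝒜 a b := by
    intro a b
    have h1 : 0 ≤ (1 : Matrix (Fin n) (Fin n) ℝ) a b := by
      rw [Matrix.one_apply]; split_ifs <;> norm_num
    have h2 : 0 ≤ Matrix.diagonal (fun i => ∑ j, 𝒜 i j) a b := by
      rw [Matrix.diagonal_apply]
      split_ifs
      · exact Finset.sum_nonneg fun j _ => h𝒜' a j
      · exact le_rfl
    have h3 := h𝒜' a b
    simp only [Smat, Matrix.add_apply, Matrix.smul_apply, smul_eq_mul]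
    positivity
  have hSm : ∀ k : ℕ, ∀ a b, 0 ≤ ((Smat ω w c₁ c₂ 𝒜) ^ k) a b := by
    intro k
    induction k with
    | zero =>
      intro a b
      rw [pow_zero, Matrix.one_apply]; split_ifs <;> norm_num
    | succ k ih =>
      intro a b
      rw [pow_succ, Matrix.mul_apply]
      exact Finset.sum_nonneg fun j _ => mul_nonneg (ih a j) (hS j b)
  refine ContinuousLinearMap.opNorm_le_bound _
    (mul_nonneg (pow_nonneg (mul_nonneg hcσ hw.le) m) (hSm m v u)) fun e => ?_
  have := (H e).2
  rw [← heq] at this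
  exact this
end OSQ
end
end

section
/- For an MPNN of depth m as specified with graph-level SUM readout, for all nodes v,u ∈ V, every input X, and all coordinates 1≤α,β≤d, the second derivative of the prediction satisfies |∂²y^{(m)}(X)/∂x_v^α∂x_u^β| ≤ Σ_{k=0}^{m−1} (c_σ w)^{2m−k−1} ( w (S^{m−k})^⊤ diag(1^⊤S^k) S^{m−k} + c^{(2)} Q_k )_{vu}. -/
open scoped BigOperators

noncomputable section

namespace OSQ

variable {n d : ℕ}

open Matrix
/-- `P_k := (S^{m−k−1})ᵀ diag(1ᵀS^k) (𝒜 S^{m−k−1})`. -/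
def Pmat (S 𝒜 : Matrix (Fin n) (Fin n) ℝ) (m k : ℕ) : Matrix (Fin n) (Fin n) ℝ :=
  (S ^ (m - k - 1))ᵀ * OSQ.colSumDiag (S ^ k) * (𝒜 * S ^ (m - k - 1))

/-- `Q_k := P_k + P_kᵀ + (S^{m−k−1})ᵀ diag(1ᵀS^k(diag(𝒜1)+𝒜)) S^{m−k−1}`. -/
def Qmat (S 𝒜 : Matrix (Fin n) (Fin n) ℝ) (m k : ℕ) : Matrix (Fin n) (Fin n) ℝ :=
  Pmat S 𝒜 m k + (Pmat S 𝒜 m k)ᵀ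
    + (S ^ (m - k - 1))ᵀ * OSQ.colSumDiag (S ^ k * (OSQ.rowSumDiag 𝒜 + 𝒜)) * S ^ (m - k - 1)

section helpers

variable {F E E' : Type*} [NormedAddCommGroup F] [NormedSpace ℝ F]
  [NormedAddCommGroup E] [NormedSpace ℝ E] [NormedAddCommGroup E'] [NormedSpace ℝ E']

/-- second directional derivative -/
def D2 (f : F → E) (X p q : F) : E := fderiv ℝ (fun Y => fderiv ℝ f Y q) X p

lemma diff_dir {f : F → E} (hf : ContDiff ℝ 2 f) (q : F) :
    Differentiable ℝ (fun Y => fderiv ℝ f Y q) := by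
  have h1 : ContDiff ℝ 1 (fderiv ℝ f) := hf.fderiv_right (by norm_num)
  exact (h1.differentiable (by norm_num)).clm_apply (differentiable_const q)

lemma diff_of {f : F → E} (hf : ContDiff ℝ 2 f) : Differentiable ℝ f :=
  hf.differentiable (by norm_num)

lemma D2_comp {g : E → E'} {f : F → E} (hg : ContDiff ℝ 2 g) (hf : ContDiff ℝ 2 f) (X p q : F) :
    D2 (fun Y => g (f Y)) X p q
      = fderiv ℝ (fderiv ℝ g) (f X) (fderiv ℝ f X p) (fderiv ℝ f X q)
        + fderiv ℝ g (f X) (D2 f X p q) := by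
  have h1 : (fun Y => fderiv ℝ (fun Y => g (f Y)) Y q)
      = fun Y => (fderiv ℝ g (f Y)) (fderiv ℝ f Y q) := by
    funext Y
    have := fderiv_comp Y (diff_of hg (f Y)) (diff_of hf Y)
    change fderiv ℝ (g ∘ f) Y q = _
    rw [this]; rfl
  have hg1 : ContDiff ℝ 1 (fderiv ℝ g) := hg.fderiv_right (by norm_num)
  have hg' : HasFDerivAt (fderiv ℝ g) (fderiv ℝ (fderiv ℝ g) (f X)) (f X) :=
    (hg1.differentiable (by norm_num) (f X)).hasFDerivAt
  have hc := hg'.comp X (diff_of hf X).hasFDerivAt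
  have hd := (diff_dir hf q X).hasFDerivAt
  have := hc.clm_apply hd
  unfold D2
  rw [h1]
  erw [this.fderiv]
  simp [add_comm]

lemma D2_clm (L : E →L[ℝ] E') {f : F → E} (hf : ContDiff ℝ 2 f) (X p q : F) :
    D2 (fun Y => L (f Y)) X p q = L (D2 f X p q) := by
  have h1 : ∀ Y, fderiv ℝ (fun Y => L (f Y)) Y = L.comp (fderiv ℝ f Y) := fun Y =>
    (L.hasFDerivAt.comp Y (diff_of hf Y).hasFDerivAt).fderiv
  unfold D2
  simp only [h1]
  have := (L.hasFDerivAt.comp X (diff_dir hf q X).hasFDerivAt).fderiv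
  change fderiv ℝ (L ∘ fun Y => fderiv ℝ f Y q) X p = _
  rw [this]; rfl

lemma D1_clm (L : E →L[ℝ] E') {f : F → E} (hf : Differentiable ℝ f) (X p : F) :
    fderiv ℝ (fun Y => L (f Y)) X p = L (fderiv ℝ f X p) := by
  have h : HasFDerivAt (fun Y => L (f Y)) (L.comp (fderiv ℝ f X)) X :=
    L.hasFDerivAt.comp X (hf X).hasFDerivAt
  rw [h.fderiv]; rfl

lemma D1_add {f g : F → E} (hf : Differentiable ℝ f) (hg : Differentiable ℝ g) (X p : F) :
    fderiv ℝ (fun Y => f Y + g Y) X p = fderiv ℝ f X p + fderiv ℝ g X p := by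
  rw [((hf X).hasFDerivAt.fun_add (hg X).hasFDerivAt).fderiv]; rfl

lemma D1_sum {ι : Type*} [Fintype ι] (a : ι → ℝ) {f : ι → F → E}
    (hf : ∀ i, Differentiable ℝ (f i)) (X p : F) :
    fderiv ℝ (fun Y => ∑ i, a i • f i Y) X p = ∑ i, a i • fderiv ℝ (f i) X p := by
  have h : HasFDerivAt (fun Y => ∑ i, a i • f i Y) (∑ i, a i • fderiv ℝ (f i) X) X :=
    HasFDerivAt.fun_sum (fun i _ => ((hf i X).hasFDerivAt.const_smul (a i)))
  rw [h.fderiv]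
  simp

lemma D2_add {f g : F → E} (hf : ContDiff ℝ 2 f) (hg : ContDiff ℝ 2 g) (X p q : F) :
    D2 (fun Y => f Y + g Y) X p q = D2 f X p q + D2 g X p q := by
  unfold D2
  simp only [D1_add (diff_of hf) (diff_of hg)]
  exact D1_add (diff_dir hf q) (diff_dir hg q) X p

lemma D2_sum {ι : Type*} [Fintype ι] (a : ι → ℝ) {f : ι → F → E}
    (hf : ∀ i, ContDiff ℝ 2 (f i)) (X p q : F) :
    D2 (fun Y => ∑ i, a i • f i Y) X p q = ∑ i, a i • D2 (f i) X p q := by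
  unfold D2
  simp only [D1_sum a (fun i => diff_of (hf i))]
  exact D1_sum a (fun i => diff_dir (hf i) q) X p

lemma D1_pair {f : F → E} {g : F → E'} (hf : Differentiable ℝ f) (hg : Differentiable ℝ g)
    (X p : F) :
    fderiv ℝ (fun Y => (f Y, g Y)) X p = (fderiv ℝ f X p, fderiv ℝ g X p) := by
  rw [((hf X).hasFDerivAt.prodMk (hg X).hasFDerivAt).fderiv]; rfl

lemma D2_pair {f : F → E} {g : F → E'} (hf : ContDiff ℝ 2 f) (hg : ContDiff ℝ 2 g) (X p q : F) :
    D2 (fun Y => (f Y, g Y)) X p q = (D2 f X p q, D2 g X p q) := by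
  unfold D2
  simp only [D1_pair (diff_of hf) (diff_of hg)]
  exact D1_pair (diff_dir hf q) (diff_dir hg q) X p

lemma norm_D1_pair_le {ψ : E × E → E'} (hψ : Differentiable ℝ ψ) {c₁ c₂ : ℝ}
    (h1 : ∀ x y, ‖fderiv ℝ (fun z => ψ (z, y)) x‖ ≤ c₁)
    (h2 : ∀ x y, ‖fderiv ℝ (fun z => ψ (x, z)) y‖ ≤ c₂) (x y a b : E) :
    ‖fderiv ℝ ψ (x, y) (a, b)‖ ≤ c₁ * ‖a‖ + c₂ * ‖b‖ := by
  have e1 : fderiv ℝ (fun z => ψ (z, y)) x a = fderiv ℝ ψ (x, y) (a, 0) := by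
    have := (hψ (x, y)).hasFDerivAt.comp x (hasFDerivAt_prodMk_left (𝕜 := ℝ) x y)
    change fderiv ℝ (ψ ∘ fun z => (z, y)) x a = _
    rw [this.fderiv]; simp
  have e2 : fderiv ℝ (fun z => ψ (x, z)) y b = fderiv ℝ ψ (x, y) (0, b) := by
    have := (hψ (x, y)).hasFDerivAt.comp y (hasFDerivAt_prodMk_right (𝕜 := ℝ) x y)
    change fderiv ℝ (ψ ∘ fun z => (x, z)) y b = _
    rw [this.fderiv]; simp
  have e3 : fderiv ℝ ψ (x, y) (a, b)
      = fderiv ℝ (fun z => ψ (z, y)) x a + fderiv ℝ (fun z => ψ (x, z)) y b := by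
    rw [e1, e2, ← map_add]; simp
  rw [e3]
  refine (norm_add_le _ _).trans (add_le_add ?_ ?_)
  · exact ((fderiv ℝ (fun z => ψ (z, y)) x).le_opNorm a).trans
      (mul_le_mul_of_nonneg_right (h1 x y) (norm_nonneg _))
  · exact ((fderiv ℝ (fun z => ψ (x, z)) y).le_opNorm b).trans
      (mul_le_mul_of_nonneg_right (h2 x y) (norm_nonneg _))

lemma norm_D2_pair_le {ψ : E × E → E'} {c : ℝ} (P : E × E)
    (h : ‖iteratedFDeriv ℝ 2 ψ P‖ ≤ c) (a b a' b' : E) :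
    ‖fderiv ℝ (fderiv ℝ ψ) P (a, b) (a', b')‖ ≤ c * ((‖a‖ + ‖b‖) * (‖a'‖ + ‖b'‖)) := by
  have e := iteratedFDeriv_two_apply (𝕜 := ℝ) ψ P ![(a, b), (a', b')]
  simp only [Matrix.cons_val_zero, Matrix.cons_val_one] at e
  rw [← e]
  refine ((iteratedFDeriv ℝ 2 ψ P).le_opNorm _).trans ?_
  rw [Fin.prod_univ_two]
  simp only [Matrix.cons_val_zero, Matrix.cons_val_one]
  have m1 : ‖(a, b)‖ ≤ ‖a‖ + ‖b‖ :=
    max_le (le_add_of_nonneg_right (norm_nonneg b)) (le_add_of_nonneg_left (norm_nonneg a))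
  have m2 : ‖(a', b')‖ ≤ ‖a'‖ + ‖b'‖ :=
    max_le (le_add_of_nonneg_right (norm_nonneg b')) (le_add_of_nonneg_left (norm_nonneg a'))
  have hc : 0 ≤ c := (norm_nonneg _).trans h
  gcongr

lemma contDiff_act {σ : ℝ → ℝ} (hσ : ContDiff ℝ 2 σ) {f : F → EuclideanSpace ℝ (Fin d)}
    (hf : ContDiff ℝ 2 f) : ContDiff ℝ 2 (fun Y => act σ (f Y)) := by
  rw [contDiff_euclidean] at hf ⊢
  intro i
  exact hσ.comp (hf i)

lemma D1_coord {f : F → EuclideanSpace ℝ (Fin d)} (hf : Differentiable ℝ f) (X p : F) (i : Fin d) :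
    (fderiv ℝ f X p) i = fderiv ℝ (fun Y => f Y i) X p :=
  (D1_clm (EuclideanSpace.proj i : EuclideanSpace ℝ (Fin d) →L[ℝ] ℝ) hf X p).symm

lemma D2_coord {f : F → EuclideanSpace ℝ (Fin d)} (hf : ContDiff ℝ 2 f) (X p q : F) (i : Fin d) :
    (D2 f X p q) i = D2 (fun Y => f Y i) X p q :=
  (D2_clm (EuclideanSpace.proj i : EuclideanSpace ℝ (Fin d) →L[ℝ] ℝ) hf X p q).symm

lemma contDiff_coord {f : F → EuclideanSpace ℝ (Fin d)} (hf : ContDiff ℝ 2 f) (i : Fin d) :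
    ContDiff ℝ 2 (fun Y => f Y i) := contDiff_euclidean.1 hf i

lemma D1_act {σ : ℝ → ℝ} (hσ : ContDiff ℝ 2 σ) {f : F → EuclideanSpace ℝ (Fin d)}
    (hf : ContDiff ℝ 2 f) (X p : F) (i : Fin d) :
    (fderiv ℝ (fun Y => act σ (f Y)) X p) i = deriv σ (f X i) * (fderiv ℝ f X p) i := by
  rw [D1_coord (diff_of (contDiff_act hσ hf)), D1_coord (diff_of hf)]
  have := (diff_of hσ (f X i)).hasDerivAt.comp_hasFDerivAt X
    (diff_of (contDiff_coord hf i) X).hasFDerivAt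
  change fderiv ℝ (σ ∘ fun Y => f Y i) X p = _
  rw [this.fderiv]; simp

lemma D2_act {σ : ℝ → ℝ} (hσ : ContDiff ℝ 2 σ) {f : F → EuclideanSpace ℝ (Fin d)}
    (hf : ContDiff ℝ 2 f) (X p q : F) (i : Fin d) :
    (D2 (fun Y => act σ (f Y)) X p q) i
      = deriv (deriv σ) (f X i) * ((fderiv ℝ f X p) i * (fderiv ℝ f X q) i)
        + deriv σ (f X i) * (D2 f X p q) i := by
  unfold D2
  rw [D1_coord (diff_dir (contDiff_act hσ hf) q)]
  simp only [D1_act hσ hf]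
  have hσ1 : ContDiff ℝ 1 (deriv σ) := by
    have := hσ.iterate_deriv' 1 1
    simpa using this
  have a1 := (hσ1.differentiable (by norm_num) (f X i)).hasDerivAt.comp_hasFDerivAt X
    (diff_of (contDiff_coord hf i) X).hasFDerivAt
  have a2 : HasFDerivAt (fun Y => (fderiv ℝ f Y q) i) _ X :=
    ((EuclideanSpace.proj i : EuclideanSpace ℝ (Fin d) →L[ℝ] ℝ).hasFDerivAt).comp X
      (diff_dir hf q X).hasFDerivAt
  have := a1.mul a2
  change fderiv ℝ ((deriv σ ∘ fun Y => f Y i) * (fun Y => (fderiv ℝ f Y q) i)) X p = _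
  rw [this.fderiv, D1_coord (diff_of hf) X p]
  simp
  ring

lemma norm_le_of_coord {a b : EuclideanSpace ℝ (Fin d)} {c : ℝ} (hc : 0 ≤ c)
    (h : ∀ i, |a i| ≤ c * |b i|) : ‖a‖ ≤ c * ‖b‖ := by
  have : ‖a‖ ≤ ‖c • b‖ := by
    rw [EuclideanSpace.norm_eq, EuclideanSpace.norm_eq]
    apply Real.sqrt_le_sqrt
    apply Finset.sum_le_sum
    intro i _
    have := h i
    simp only [Real.norm_eq_abs, PiLp.smul_apply, smul_eq_mul, abs_mul, abs_of_nonneg hc]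
    gcongr
  rwa [norm_smul, Real.norm_of_nonneg hc] at this

lemma norm_le_of_coord_mul {a b b' : EuclideanSpace ℝ (Fin d)} {c : ℝ} (hc : 0 ≤ c)
    (h : ∀ i, |a i| ≤ c * (|b i| * |b' i|)) : ‖a‖ ≤ c * (‖b‖ * ‖b'‖) := by
  have := norm_le_of_coord (a := a) (b := b) (c := c * ‖b'‖) (by positivity) (fun i => by
    refine (h i).trans ?_
    have h1 : |b' i| ≤ ‖b'‖ := by simpa using PiLp.norm_apply_le b' i
    have : c * (|b i| * |b' i|) ≤ c * (|b i| * ‖b'‖) := by gcongr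
    linarith)
  linarith

lemma norm_D1_act_le {σ : ℝ → ℝ} (hσ : ContDiff ℝ 2 σ) {cσ : ℝ} (hσ' : ∀ x, |deriv σ x| ≤ cσ)
    {f : F → EuclideanSpace ℝ (Fin d)} (hf : ContDiff ℝ 2 f) (X p : F) :
    ‖fderiv ℝ (fun Y => act σ (f Y)) X p‖ ≤ cσ * ‖fderiv ℝ f X p‖ := by
  have hc : 0 ≤ cσ := (abs_nonneg _).trans (hσ' 0)
  refine norm_le_of_coord hc fun i => ?_
  rw [D1_act hσ hf, abs_mul]
  have := hσ' (f X i)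
  gcongr

lemma norm_D2_act_le {σ : ℝ → ℝ} (hσ : ContDiff ℝ 2 σ) {cσ : ℝ} (hσ' : ∀ x, |deriv σ x| ≤ cσ)
    (hσ'' : ∀ x, |deriv (deriv σ) x| ≤ cσ)
    {f : F → EuclideanSpace ℝ (Fin d)} (hf : ContDiff ℝ 2 f) (X p q : F) :
    ‖D2 (fun Y => act σ (f Y)) X p q‖
      ≤ cσ * (‖fderiv ℝ f X p‖ * ‖fderiv ℝ f X q‖) + cσ * ‖D2 f X p q‖ := by
  have hc : 0 ≤ cσ := (abs_nonneg _).trans (hσ' 0)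
  have e : D2 (fun Y => act σ (f Y)) X p q
      = WithLp.toLp 2 (fun i => deriv (deriv σ) (f X i) * ((fderiv ℝ f X p) i * (fderiv ℝ f X q) i))
        + WithLp.toLp 2 (fun i => deriv σ (f X i) * (D2 f X p q) i) := by
    ext i
    rw [D2_act hσ hf]; rfl
  rw [e]
  refine (norm_add_le _ _).trans (add_le_add ?_ ?_)
  · refine norm_le_of_coord_mul hc fun i => ?_
    have := hσ'' (f X i)
    simp only [abs_mul]
    gcongr
  · refine norm_le_of_coord hc fun i => ?_
    have := hσ' (f X i)
    simp only [abs_mul]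
    gcongr

end helpers

section layer

variable {F E : Type*} [NormedAddCommGroup F] [NormedSpace ℝ F]
  [NormedAddCommGroup E] [NormedSpace ℝ E]

lemma sum_S (ω w c₁ c₂ : ℝ) (𝒜 : Matrix (Fin n) (Fin n) ℝ) (i : Fin n) (x : Fin n → ℝ) :
    ∑ j, Smat ω w c₁ c₂ 𝒜 i j * x j
      = ω / w * x i + ∑ j, 𝒜 i j * (c₁ * x i + c₂ * x j) := by
  simp [Smat, Matrix.one_apply, Matrix.diagonal_apply, add_mul, mul_add, Finset.sum_add_distrib,
    Finset.sum_mul, Finset.mul_sum, add_assoc]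
  congr 1
  · apply Finset.sum_congr rfl; intros; ring
  · apply Finset.sum_congr rfl; intros; ring

lemma contDiff_pre (𝒜 : Matrix (Fin n) (Fin n) ℝ) (Om Wm : E →L[ℝ] E) {ψ : E × E → E}
    (hψ : ContDiff ℝ 2 ψ) {h : Fin n → F → E} (hh : ∀ i, ContDiff ℝ 2 (h i)) (i : Fin n) :
    ContDiff ℝ 2 (fun Y => Om (h i Y) + Wm (∑ j, 𝒜 i j • ψ (h i Y, h j Y))) := by
  refine (Om.contDiff.comp (hh i)).add (Wm.contDiff.comp ?_)
  exact ContDiff.sum fun j _ => (hψ.comp ((hh i).prodMk (hh j))).const_smul (𝒜 i j)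

lemma bound_lin {𝒜 : Matrix (Fin n) (Fin n) ℝ} (h𝒜 : ∀ i j, 0 ≤ 𝒜 i j) {Om Wm : E →L[ℝ] E}
    {ω w c₁ c₂ : ℝ} (hw : 0 < w) (hO : ‖Om‖ ≤ ω) (hW : ‖Wm‖ ≤ w)
    (i : Fin n) (g : E) (y : Fin n → E) (x R : Fin n → ℝ) (hg : ‖g‖ ≤ x i)
    (hy : ∀ j, ‖y j‖ ≤ R j + (c₁ * x i + c₂ * x j)) :
    ‖Om g + Wm (∑ j, 𝒜 i j • y j)‖
      ≤ w * ∑ j, Smat ω w c₁ c₂ 𝒜 i j * x j + w * ∑ j, 𝒜 i j * R j := by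
  have hω : 0 ≤ ω := (norm_nonneg _).trans hO
  have h1 : ‖Om g‖ ≤ ω * x i := (Om.le_opNorm g).trans (by gcongr)
  have h2 : ‖∑ j, 𝒜 i j • y j‖ ≤ ∑ j, 𝒜 i j * (R j + (c₁ * x i + c₂ * x j)) := by
    refine norm_sum_le_of_le _ fun j _ => ?_
    rw [norm_smul, Real.norm_of_nonneg (h𝒜 i j)]
    exact mul_le_mul_of_nonneg_left (hy j) (h𝒜 i j)
  have h3 : ‖Wm (∑ j, 𝒜 i j • y j)‖ ≤ w * ∑ j, 𝒜 i j * (R j + (c₁ * x i + c₂ * x j)) :=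
    (Wm.le_opNorm _).trans (by gcongr)
  refine (norm_add_le _ _).trans ((add_le_add h1 h3).trans_eq ?_)
  rw [sum_S]
  simp only [mul_add (𝒜 i _) (R _), Finset.sum_add_distrib]
  field_simp
  ring

lemma D1_pre_le {𝒜 : Matrix (Fin n) (Fin n) ℝ} (h𝒜 : ∀ i j, 0 ≤ 𝒜 i j) {Om Wm : E →L[ℝ] E}
    {ω w c₁ c₂ : ℝ} (hw : 0 < w) (hO : ‖Om‖ ≤ ω) (hW : ‖Wm‖ ≤ w) (hc₁ : 0 ≤ c₁) (hc₂ : 0 ≤ c₂)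
    {ψ : E × E → E} (hψ : ContDiff ℝ 2 ψ)
    (hψ₁ : ∀ x y, ‖fderiv ℝ (fun z => ψ (z, y)) x‖ ≤ c₁)
    (hψ₂ : ∀ x y, ‖fderiv ℝ (fun z => ψ (x, z)) y‖ ≤ c₂)
    {h : Fin n → F → E} (hh : ∀ i, ContDiff ℝ 2 (h i)) (i : Fin n) (X p : F)
    (x : Fin n → ℝ) (hx : ∀ j, ‖fderiv ℝ (h j) X p‖ ≤ x j) :
    ‖fderiv ℝ (fun Y => Om (h i Y) + Wm (∑ j, 𝒜 i j • ψ (h i Y, h j Y))) X p‖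
      ≤ w * ∑ j, Smat ω w c₁ c₂ 𝒜 i j * x j := by
  have hp : ∀ j, ContDiff ℝ 2 (fun Y => (h i Y, h j Y)) := fun j => (hh i).prodMk (hh j)
  have hc : ∀ j, ContDiff ℝ 2 (fun Y => ψ (h i Y, h j Y)) := fun j => hψ.comp (hp j)
  have hs : ContDiff ℝ 2 (fun Y => ∑ j, 𝒜 i j • ψ (h i Y, h j Y)) :=
    ContDiff.sum fun j _ => (hc j).const_smul (𝒜 i j)
  rw [D1_add (f := fun Y => Om (h i Y)) (diff_of (Om.contDiff.comp (hh i))) 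
      (g := fun Y => Wm (∑ j, 𝒜 i j • ψ (h i Y, h j Y))) (diff_of (Wm.contDiff.comp hs)),
    D1_clm Om (diff_of (hh i)), D1_clm Wm (diff_of hs), D1_sum _ (fun j => diff_of (hc j))]
  have := bound_lin h𝒜 hw hO hW i (fderiv ℝ (h i) X p)
    (fun j => fderiv ℝ (fun Y => ψ (h i Y, h j Y)) X p) x 0 (hx i) (fun j => by
      have e := fderiv_comp X (diff_of hψ (h i X, h j X)) (diff_of (hp j) X)
      change ‖fderiv ℝ (ψ ∘ (fun Y => (h i Y, h j Y))) X p‖ ≤ _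
      rw [e, ContinuousLinearMap.comp_apply, D1_pair (diff_of (hh i)) (diff_of (hh j))]
      refine (norm_D1_pair_le (diff_of hψ) hψ₁ hψ₂ _ _ _ _).trans ?_
      have h1 := hx i
      have h2 := hx j
      simp only [Pi.zero_apply, zero_add]
      gcongr)
  simpa using this

lemma D2_pre_le {𝒜 : Matrix (Fin n) (Fin n) ℝ} (h𝒜 : ∀ i j, 0 ≤ 𝒜 i j) {Om Wm : E →L[ℝ] E}
    {ω w c₁ c₂ c2 : ℝ} (hw : 0 < w) (hO : ‖Om‖ ≤ ω) (hW : ‖Wm‖ ≤ w) (hc₁ : 0 ≤ c₁) (hc₂ : 0 ≤ c₂)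
    {ψ : E × E → E} (hψ : ContDiff ℝ 2 ψ)
    (hψ₁ : ∀ x y, ‖fderiv ℝ (fun z => ψ (z, y)) x‖ ≤ c₁)
    (hψ₂ : ∀ x y, ‖fderiv ℝ (fun z => ψ (x, z)) y‖ ≤ c₂)
    (hψ₃ : ∀ p, ‖iteratedFDeriv ℝ 2 ψ p‖ ≤ c2) (hc2 : 0 ≤ c2)
    {h : Fin n → F → E} (hh : ∀ i, ContDiff ℝ 2 (h i)) (i : Fin n) (X p q : F)
    (a b x : Fin n → ℝ) (ha : ∀ j, ‖fderiv ℝ (h j) X p‖ ≤ a j)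
    (hb : ∀ j, ‖fderiv ℝ (h j) X q‖ ≤ b j)
    (hx : ∀ j, ‖D2 (h j) X p q‖ ≤ x j) :
    ‖D2 (fun Y => Om (h i Y) + Wm (∑ j, 𝒜 i j • ψ (h i Y, h j Y))) X p q‖
      ≤ w * ∑ j, Smat ω w c₁ c₂ 𝒜 i j * x j
        + w * ∑ j, 𝒜 i j * (c2 * ((a i + a j) * (b i + b j))) := by
  have hp : ∀ j, ContDiff ℝ 2 (fun Y => (h i Y, h j Y)) := fun j => (hh i).prodMk (hh j)
  have hc : ∀ j, ContDiff ℝ 2 (fun Y => ψ (h i Y, h j Y)) := fun j => hψ.comp (hp j)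
  have hs : ContDiff ℝ 2 (fun Y => ∑ j, 𝒜 i j • ψ (h i Y, h j Y)) :=
    ContDiff.sum fun j _ => (hc j).const_smul (𝒜 i j)
  rw [D2_add (f := fun Y => Om (h i Y)) (Om.contDiff.comp (hh i))
      (g := fun Y => Wm (∑ j, 𝒜 i j • ψ (h i Y, h j Y))) (Wm.contDiff.comp hs),
    D2_clm Om (hh i), D2_clm Wm hs, D2_sum _ hc]
  refine bound_lin h𝒜 hw hO hW i (D2 (h i) X p q)
    (fun j => D2 (fun Y => ψ (h i Y, h j Y)) X p q) x
    (fun j => c2 * ((a i + a j) * (b i + b j))) (hx i) (fun j => ?_)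
  rw [D2_comp hψ (hp j), D1_pair (diff_of (hh i)) (diff_of (hh j)),
    D1_pair (diff_of (hh i)) (diff_of (hh j)), D2_pair (hh i) (hh j)]
  refine (norm_add_le _ _).trans (add_le_add ?_ ?_)
  · refine (norm_D2_pair_le _ (hψ₃ _) _ _ _ _).trans ?_
    have h1 := ha i
    have h2 := ha j
    have h3 := hb i
    have h4 := hb j
    have h5 := (norm_nonneg _).trans h1
    have h6 := (norm_nonneg _).trans h2
    gcongr
  · refine (norm_D1_pair_le (diff_of hψ) hψ₁ hψ₂ _ _ _ _).trans ?_
    have h1 := hx i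
    have h2 := hx j
    gcongr

end layer

/-- local source term in the second derivative recursion -/
def Tsrc (S 𝒜 : Matrix (Fin n) (Fin n) ℝ) (w c2 : ℝ) (v u : Fin n) (s : ℕ) (i : Fin n) : ℝ :=
  w * ((S ^ s) i v * (S ^ s) i u) + c2 * ∑ j, 𝒜 i j *
    (((S ^ (s - 1)) i v + (S ^ (s - 1)) j v) * ((S ^ (s - 1)) i u + (S ^ (s - 1)) j u))

/-- bound on the node-level second derivative -/
def Hb (S 𝒜 : Matrix (Fin n) (Fin n) ℝ) (w c2 r : ℝ) (v u : Fin n) : ℕ → Fin n → ℝ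
  | 0, _ => 0
  | t + 1, i => r * ∑ j, S i j * Hb S 𝒜 w c2 r v u t j
      + r ^ (2 * t + 1) * Tsrc S 𝒜 w c2 v u (t + 1) i

lemma Hb_closed (S 𝒜 : Matrix (Fin n) (Fin n) ℝ) (w c2 r : ℝ) (v u : Fin n) (m : ℕ) (i : Fin n) :
    Hb S 𝒜 w c2 r v u m i = ∑ k ∈ Finset.range m, r ^ (2 * m - k - 1) *
      ∑ j, (S ^ k) i j * Tsrc S 𝒜 w c2 v u (m - k) j := by
  induction m generalizing i with
  | zero => simp [Hb]
  | succ t ih =>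
    rw [Finset.sum_range_succ', Hb]
    congr 1
    · simp only [ih, Finset.mul_sum]
      rw [Finset.sum_comm]
      apply Finset.sum_congr rfl
      intro k hk
      have hk' := Finset.mem_range.1 hk
      have e1 : 2 * (t + 1) - (k + 1) - 1 = (2 * t - k - 1) + 1 := by omega
      have e2 : t + 1 - (k + 1) = t - k := by omega
      rw [e1, e2, Finset.sum_comm]
      apply Finset.sum_congr rfl
      intro j _
      rw [pow_succ' S, Matrix.mul_apply, Finset.sum_mul, Finset.mul_sum]
      apply Finset.sum_congr rfl
      intro l _
      ring
    · have e1 : 2 * (t + 1) - 0 - 1 = 2 * t + 1 := by omega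
      rw [e1]
      simp [Matrix.one_apply]

lemma sum_T (S 𝒜 : Matrix (Fin n) (Fin n) ℝ) (w c2 : ℝ) (v u : Fin n) (m k : ℕ) :
    ∑ i, ∑ j, (S ^ k) i j * Tsrc S 𝒜 w c2 v u (m - k) j
      = (w • (S ^ (m - k))ᵀ * OSQ.colSumDiag (S ^ k) * S ^ (m - k) + c2 • Qmat S 𝒜 m k) v u := by
  rw [Finset.sum_comm]
  simp only [← Finset.sum_mul]
  simp only [Qmat, Pmat, colSumDiag, rowSumDiag, Matrix.add_apply, Matrix.smul_apply,
    Matrix.transpose_apply, smul_eq_mul, Tsrc]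
  generalize S ^ (m - k) = B
  generalize S ^ (m - k - 1) = C
  generalize S ^ k = K
  set κ : Fin n → ℝ := fun j => ∑ i, K i j with hκ
  have hcol : ∀ j, ∑ i, (K * (Matrix.diagonal (fun i => ∑ j, 𝒜 i j) + 𝒜)) i j
      = κ j * (∑ l, 𝒜 j l) + ∑ i, κ i * 𝒜 i j := by
    intro j
    rw [Matrix.mul_add]
    simp only [Matrix.add_apply, Matrix.mul_diagonal, Finset.sum_add_distrib]
    congr 1
    · simp only [hκ, Finset.sum_mul]
    · simp only [hκ, Finset.sum_mul, Matrix.mul_apply]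
      rw [Finset.sum_comm]
  have hκ' : ∀ j, ∑ i, K i j = κ j := fun _ => rfl
  simp only [hcol, hκ']
  clear_value κ
  simp only [Matrix.mul_apply (N := B), Matrix.mul_apply (N := C), Matrix.mul_apply (N := 𝒜 * C),
    Matrix.mul_diagonal, Matrix.transpose_apply, Matrix.smul_apply, smul_eq_mul]
  simp only [mul_add, add_mul, Finset.sum_add_distrib, Finset.mul_sum, Finset.sum_mul]
  have sw : ∀ f : Fin n → Fin n → ℝ, ∑ i, ∑ j, f i j = ∑ j, ∑ i, f i j :=
    fun f => Finset.sum_comm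
  have e1 : ∑ x, ∑ i, c2 * (C x v * (κ i * 𝒜 i x) * C x u)
      = ∑ x, ∑ i, c2 * (C i v * (κ x * 𝒜 x i) * C i u) := sw _
  rw [e1]
  simp only [← Finset.sum_add_distrib]
  apply Finset.sum_congr rfl
  intro i _
  congr 1
  · ring
  · apply Finset.sum_congr rfl
    intro j _
    ring

/-- Theorem 3.2: bound on the mixing induced by an MPNN with SUM readout. -/
theorem mixing_bound
    (G : SimpleGraph (Fin n)) [DecidableRel G.Adj] (hconn : G.Connected)
    (𝒜 : Matrix (Fin n) (Fin n) ℝ)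
    (h𝒜 : ∀ a b, (G.Adj a b → 0 < 𝒜 a b) ∧ (¬ G.Adj a b → 𝒜 a b = 0))
    (σ : ℝ → ℝ) (hσ : ContDiff ℝ 2 σ) (cσ : ℝ)
    (hσ' : ∀ x, |deriv σ x| ≤ cσ) (hσ'' : ∀ x, |deriv (deriv σ) x| ≤ cσ)
    (Ω W : ℕ → EuclideanSpace ℝ (Fin d) →L[ℝ] EuclideanSpace ℝ (Fin d))
    (ω w : ℝ) (hw : 0 < w) (hΩ : ∀ t, ‖Ω t‖ ≤ ω) (hW : ∀ t, ‖W t‖ ≤ w)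
    (ψ : ℕ → EuclideanSpace ℝ (Fin d) × EuclideanSpace ℝ (Fin d) → EuclideanSpace ℝ (Fin d))
    (hψ : ∀ t, ContDiff ℝ 2 (ψ t)) (c₁ c₂ c2 : ℝ)
    (hψ₁ : ∀ t x y, ‖fderiv ℝ (fun z => ψ t (z, y)) x‖ ≤ c₁)
    (hψ₂ : ∀ t x y, ‖fderiv ℝ (fun z => ψ t (x, z)) y‖ ≤ c₂)
    (hψ₃ : ∀ t p, ‖iteratedFDeriv ℝ 2 (ψ t) p‖ ≤ c2)
    (θ : EuclideanSpace ℝ (Fin d)) (hθ : ‖θ‖ = 1)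
    (m : ℕ) (v u : Fin n) (X : Fin n → EuclideanSpace ℝ (Fin d)) (α β : Fin d) :
    |OSQ.mixEntry θ σ 𝒜 Ω W ψ m v u X α β|
      ≤ ∑ k ∈ Finset.range m, (cσ * w) ^ (2 * m - k - 1) *
          ((w • ((OSQ.Smat ω w c₁ c₂ 𝒜) ^ (m - k))ᵀ *
              OSQ.colSumDiag ((OSQ.Smat ω w c₁ c₂ 𝒜) ^ k) * (OSQ.Smat ω w c₁ c₂ 𝒜) ^ (m - k)
            + c2 • Qmat (OSQ.Smat ω w c₁ c₂ 𝒜) 𝒜 m k) v u) := by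
  have hcσ : 0 ≤ cσ := (abs_nonneg _).trans (hσ' 0)
  have hA : ∀ i j, 0 ≤ 𝒜 i j := fun i j => by
    by_cases hij : G.Adj i j
    · exact ((h𝒜 i j).1 hij).le
    · exact ((h𝒜 i j).2 hij).ge
  have hc₁ : 0 ≤ c₁ := (norm_nonneg _).trans (hψ₁ 0 0 0)
  have hc₂ : 0 ≤ c₂ := (norm_nonneg _).trans (hψ₂ 0 0 0)
  have hc2 : 0 ≤ c2 := (norm_nonneg _).trans (hψ₃ 0 0)
  set S := OSQ.Smat ω w c₁ c₂ 𝒜 with hS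
  have hsm : ∀ t i, ContDiff ℝ 2 (fun Y => mpnn σ 𝒜 Ω W ψ t Y i) := by
    intro t
    induction t with
    | zero => exact fun i => contDiff_apply ℝ _ i
    | succ t ih =>
      exact fun i => contDiff_act hσ (contDiff_pre 𝒜 (Ω (t+1)) (W (t+1)) (hψ (t+1)) ih i)
  have hJ : ∀ (a : Fin n) (γ : Fin d) (t : ℕ) (i : Fin n),
      ‖fderiv ℝ (fun Y => mpnn σ 𝒜 Ω W ψ t Y i) X (dir a γ)‖ ≤ (cσ * w) ^ t * (S ^ t) i a := by
    intro a γ t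
    induction t with
    | zero =>
      intro i
      have e : fderiv ℝ (fun Y : Fin n → EuclideanSpace ℝ (Fin d) => mpnn σ 𝒜 Ω W ψ 0 Y i) X
          (dir a γ) = dir a γ i := by
        have h0 : HasFDerivAt (fun Y => mpnn σ 𝒜 Ω W ψ 0 Y i)
          (ContinuousLinearMap.proj (R := ℝ) (φ := fun _ : Fin n => EuclideanSpace ℝ (Fin d)) i) X :=
          hasFDerivAt_apply i X
        rw [h0.fderiv]
        rfl
      rw [e, dir]
      by_cases h : i = a
      · subst h; simp
      · simp [h]
    | succ t ih =>
      intro i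
      have h1 := norm_D1_act_le hσ hσ'
        (contDiff_pre 𝒜 (Ω (t+1)) (W (t+1)) (hψ (t+1)) (hsm t) i) X (dir a γ)
      have h2 := D1_pre_le hA hw (hΩ (t+1)) (hW (t+1)) hc₁ hc₂ (hψ (t+1)) (hψ₁ (t+1)) (hψ₂ (t+1))
        (hsm t) i X (dir a γ) _ ih
      refine h1.trans ((mul_le_mul_of_nonneg_left h2 hcσ).trans_eq ?_)
      rw [← hS, pow_succ' S, Matrix.mul_apply, Finset.mul_sum, Finset.mul_sum, Finset.mul_sum]
      apply Finset.sum_congr rfl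
      intro j _
      ring
  have hH : ∀ (t : ℕ) (i : Fin n),
      ‖D2 (fun Y => mpnn σ 𝒜 Ω W ψ t Y i) X (dir v α) (dir u β)‖
        ≤ Hb S 𝒜 w c2 (cσ * w) v u t i := by
    intro t
    induction t with
    | zero =>
      intro i
      have e : ∀ Y, fderiv ℝ (fun Y : Fin n → EuclideanSpace ℝ (Fin d) =>
          mpnn σ 𝒜 Ω W ψ 0 Y i) Y (dir u β) = dir u β i := by
        intro Y
        have h0 : HasFDerivAt (fun Y => mpnn σ 𝒜 Ω W ψ 0 Y i)
          (ContinuousLinearMap.proj (R := ℝ) (φ := fun _ : Fin n => EuclideanSpace ℝ (Fin d)) i) Y :=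
          hasFDerivAt_apply i Y
        rw [h0.fderiv]
        rfl
      unfold D2
      simp only [e]
      simp [Hb]
    | succ t ih =>
      intro i
      have hpre := contDiff_pre 𝒜 (Ω (t+1)) (W (t+1)) (hψ (t+1)) (hsm t) i
      have h1 := norm_D2_act_le hσ hσ' hσ'' hpre X (dir v α) (dir u β)
      have h2 := D1_pre_le hA hw (hΩ (t+1)) (hW (t+1)) hc₁ hc₂ (hψ (t+1)) (hψ₁ (t+1)) (hψ₂ (t+1))
        (hsm t) i X (dir v α) _ (hJ v α t)
      have h3 := D1_pre_le hA hw (hΩ (t+1)) (hW (t+1)) hc₁ hc₂ (hψ (t+1)) (hψ₁ (t+1)) (hψ₂ (t+1))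
        (hsm t) i X (dir u β) _ (hJ u β t)
      have h4 := D2_pre_le hA hw (hΩ (t+1)) (hW (t+1)) hc₁ hc₂ (hψ (t+1)) (hψ₁ (t+1)) (hψ₂ (t+1))
        (hψ₃ (t+1)) hc2 (hsm t) i X (dir v α) (dir u β) _ _ _ (hJ v α t) (hJ u β t) ih
      have h5 := add_le_add (mul_le_mul_of_nonneg_left (mul_le_mul h2 h3 (norm_nonneg _)
        ((norm_nonneg _).trans h2)) hcσ) (mul_le_mul_of_nonneg_left h4 hcσ)
      refine h1.trans (h5.trans_eq ?_)
      have hp : ∀ a, ∑ j, S i j * ((cσ * w) ^ t * (S ^ t) j a)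
          = (cσ * w) ^ t * (S ^ (t+1)) i a := by
        intro a
        rw [pow_succ' S, Matrix.mul_apply, Finset.mul_sum]
        apply Finset.sum_congr rfl
        intro j _
        ring
      have hq : ∑ j, 𝒜 i j * (c2 * (((cσ * w) ^ t * (S ^ t) i v + (cσ * w) ^ t * (S ^ t) j v) *
            ((cσ * w) ^ t * (S ^ t) i u + (cσ * w) ^ t * (S ^ t) j u)))
          = (cσ * w) ^ (2 * t) * (c2 * ∑ j, 𝒜 i j *
              (((S ^ t) i v + (S ^ t) j v) * ((S ^ t) i u + (S ^ t) j u))) := by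
        rw [Finset.mul_sum, Finset.mul_sum]
        apply Finset.sum_congr rfl
        intro j _
        ring
      rw [← hS, hp, hp, hq, Hb, Tsrc, Nat.add_sub_cancel]
      ring
  have hread : (fun Z => readout θ σ 𝒜 Ω W ψ m Z)
      = fun Z => (innerSL ℝ θ) (∑ i, (1 : ℝ) • mpnn σ 𝒜 Ω W ψ m Z i) := by
    funext Z
    simp [readout, PiLp.inner_apply, mul_comm]
    simp only [Finset.mul_sum]
    exact Finset.sum_comm
  have hmix : mixEntry θ σ 𝒜 Ω W ψ m v u X α β
      = (innerSL ℝ θ) (∑ i, (1 : ℝ) •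
          D2 (fun Y => mpnn σ 𝒜 Ω W ψ m Y i) X (dir v α) (dir u β)) := by
    have hs : ContDiff ℝ 2 (fun Z => ∑ i, (1 : ℝ) • mpnn σ 𝒜 Ω W ψ m Z i) :=
      ContDiff.sum fun i _ => (hsm m i).const_smul (1 : ℝ)
    rw [← D2_sum (fun _ => (1 : ℝ)) (hsm m), ← D2_clm (innerSL ℝ θ) hs, ← hread]
    rfl
  rw [hmix]
  have hfin : ‖(innerSL ℝ θ) (∑ i, (1 : ℝ) •
          D2 (fun Y => mpnn σ 𝒜 Ω W ψ m Y i) X (dir v α) (dir u β))‖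
      ≤ ∑ i, Hb S 𝒜 w c2 (cσ * w) v u m i := by
    refine ((innerSL ℝ θ).le_opNorm _).trans ?_
    rw [innerSL_apply_norm, hθ, one_mul]
    refine norm_sum_le_of_le _ fun i _ => ?_
    rw [one_smul]
    exact hH m i
  rw [Real.norm_eq_abs] at hfin
  refine hfin.trans_eq ?_
  simp only [Hb_closed]
  rw [Finset.sum_comm]
  apply Finset.sum_congr rfl
  intro k _
  rw [← Finset.mul_sum, sum_T]
end OSQ
end
end

section
/- For an MPNN of depth m as specified with graph-level SUM readout, if the geodesic (shortest-path) distance between nodes v and u satisfies d_G(v,u) > 2m, then for every input X and all coordinates 1≤α,β≤d the mixed second derivative ∂²y^{(m)}(X)/∂x_v^α∂x_u^β vanishes identically, i.e. the MPNN induces zero mixing among the features of v and u. -/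
open scoped BigOperators

noncomputable section

namespace OSQ

variable {n d : ℕ}

lemma fderiv_apply_eq_zero_of_invariant {E : Type*} [NormedAddCommGroup E] [NormedSpace ℝ E]
    (g : E → ℝ) (w X : E) (h : ∀ s : ℝ, g (X + s • w) = g X) : fderiv ℝ g X w = 0 := by
  by_cases hg : DifferentiableAt ℝ g X
  · rw [← hg.lineDeriv_eq_fderiv, lineDeriv]
    simp [h]
  · simp [fderiv_zero_of_not_differentiableAt hg]

lemma mpnn_differentiable (σ : ℝ → ℝ) (hσ : ContDiff ℝ 2 σ) (𝒜 : Matrix (Fin n) (Fin n) ℝ)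
    (Ω W : ℕ → EuclideanSpace ℝ (Fin d) →L[ℝ] EuclideanSpace ℝ (Fin d))
    (ψ : ℕ → EuclideanSpace ℝ (Fin d) × EuclideanSpace ℝ (Fin d) → EuclideanSpace ℝ (Fin d))
    (hψ : ∀ t, ContDiff ℝ 2 (ψ t)) (t : ℕ) :
    ∀ i, Differentiable ℝ (fun X => mpnn σ 𝒜 Ω W ψ t X i) := by
  have hσ' : Differentiable ℝ σ := hσ.differentiable (by norm_num)
  have hψ' : ∀ t, Differentiable ℝ (ψ t) := fun t => (hψ t).differentiable (by norm_num)
  induction t with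
  | zero => intro i; simp only [mpnn]; fun_prop
  | succ t ih =>
    intro i
    have hin : Differentiable ℝ (fun X => Ω (t+1) (mpnn σ 𝒜 Ω W ψ t X i)
      + W (t+1) (∑ u : Fin n, 𝒜 i u •
          ψ (t+1) (mpnn σ 𝒜 Ω W ψ t X i, mpnn σ 𝒜 Ω W ψ t X u))) := by
      have hs : ∀ u, Differentiable ℝ (fun X =>
          ψ (t+1) (mpnn σ 𝒜 Ω W ψ t X i, mpnn σ 𝒜 Ω W ψ t X u)) :=
        fun u => (hψ' (t+1)).comp ((ih i).prodMk (ih u))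
      exact ((Ω (t+1)).differentiable.comp (ih i)).add ((W (t+1)).differentiable.comp
        (Differentiable.fun_sum (fun u _ => (hs u).const_smul (𝒜 i u))))
    rw [differentiable_euclidean]
    intro k
    simp only [mpnn, act]
    rw [differentiable_euclidean] at hin
    exact hσ'.comp (hin k)

lemma mpnn_local (G : SimpleGraph (Fin n)) (hconn : G.Connected)
    (𝒜 : Matrix (Fin n) (Fin n) ℝ) (h𝒜 : ∀ a b, ¬ G.Adj a b → 𝒜 a b = 0) (σ : ℝ → ℝ)
    (Ω W : ℕ → EuclideanSpace ℝ (Fin d) →L[ℝ] EuclideanSpace ℝ (Fin d))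
    (ψ : ℕ → EuclideanSpace ℝ (Fin d) × EuclideanSpace ℝ (Fin d) → EuclideanSpace ℝ (Fin d))
    (X Y : Fin n → EuclideanSpace ℝ (Fin d)) (u : Fin n) (hXY : ∀ w, w ≠ u → X w = Y w)
    (t : ℕ) : ∀ i, t < G.dist i u → mpnn σ 𝒜 Ω W ψ t X i = mpnn σ 𝒜 Ω W ψ t Y i := by
  induction t with
  | zero =>
    intro i hi
    simp only [mpnn]
    apply hXY
    rintro rfl
    simp at hi
  | succ t ih =>
    intro i hi
    simp only [mpnn]
    have hi' := ih i (by omega)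
    rw [hi']
    congr 3
    apply Finset.sum_congr rfl
    intro j _
    by_cases hj : G.Adj i j
    · have h1 : G.dist i j = 1 := SimpleGraph.dist_eq_one_iff_adj.mpr hj
      have h2 := hconn.dist_triangle (u := i) (v := j) (w := u)
      rw [ih j (by omega)]
    · simp [h𝒜 i j hj]

lemma dir_agree (X : Fin n → EuclideanSpace ℝ (Fin d)) (s : ℝ) (u : Fin n) (β : Fin d) :
    ∀ w, w ≠ u → (X + s • dir u β) w = X w := by
  intro w hw
  simp [dir, Pi.single_eq_of_ne hw]

/-- under-reaching for the mixing: if `d_G(v,u) > 2m`, then the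
MPNN with SUM readout induces zero mixing among the features of `v` and `u`. -/
theorem underreaching_mixing
    (G : SimpleGraph (Fin n)) [DecidableRel G.Adj] (hconn : G.Connected)
    (𝒜 : Matrix (Fin n) (Fin n) ℝ)
    (h𝒜 : ∀ a b, (G.Adj a b → 0 < 𝒜 a b) ∧ (¬ G.Adj a b → 𝒜 a b = 0))
    (σ : ℝ → ℝ) (hσ : ContDiff ℝ 2 σ)
    (Ω W : ℕ → EuclideanSpace ℝ (Fin d) →L[ℝ] EuclideanSpace ℝ (Fin d))
    (ψ : ℕ → EuclideanSpace ℝ (Fin d) × EuclideanSpace ℝ (Fin d) → EuclideanSpace ℝ (Fin d))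
    (hψ : ∀ t, ContDiff ℝ 2 (ψ t))
    (θ : EuclideanSpace ℝ (Fin d)) (hθ : ‖θ‖ = 1)
    (m : ℕ) (v u : Fin n) (hdist : 2 * m < G.dist v u) :
    ∀ (X : Fin n → EuclideanSpace ℝ (Fin d)) (α β : Fin d),
      OSQ.mixEntry θ σ 𝒜 Ω W ψ m v u X α β = 0 := by
  intro X α β
  have hloc := mpnn_local G hconn 𝒜 (fun a b => (h𝒜 a b).2) σ Ω W ψ
  have hdiff := mpnn_differentiable σ hσ 𝒜 Ω W ψ hψ m
  let c : Fin n → (Fin n → EuclideanSpace ℝ (Fin d)) → ℝ :=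
    fun i Z => ∑ a : Fin d, θ a * mpnn σ 𝒜 Ω W ψ m Z i a
  have hc : ∀ i, Differentiable ℝ (c i) := by
    intro i
    have := fun a => (differentiable_euclidean.mp (hdiff i)) a
    simp only [c]
    fun_prop
  have hr : ∀ Z, readout θ σ 𝒜 Ω W ψ m Z = ∑ i, c i Z := by
    intro Z
    simp only [readout, c]
    rw [Finset.sum_comm]
    simp [Finset.mul_sum]
  have hinv : ∀ i w, m < G.dist i w → ∀ Z (s : ℝ) (b : Fin d), c i (Z + s • dir w b) = c i Z := by
    intro i w hw Z s b
    simp only [c, hloc _ _ w (dir_agree Z s w b) m i hw]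
  unfold mixEntry
  apply fderiv_apply_eq_zero_of_invariant
  intro s
  simp only [hr]
  rw [fderiv_fun_sum (fun i _ => (hc i).differentiableAt),
    fderiv_fun_sum (fun i _ => (hc i).differentiableAt)]
  simp only [ContinuousLinearMap.sum_apply]
  apply Finset.sum_congr rfl
  intro i _
  by_cases hi : m < G.dist i u
  · rw [fderiv_apply_eq_zero_of_invariant _ _ _ (fun s => hinv i u hi _ s β),
      fderiv_apply_eq_zero_of_invariant _ _ _ (fun s => hinv i u hi _ s β)]
  · have h2 := hconn.dist_triangle (u := v) (v := i) (w := u)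
    have h3 : m < G.dist i v := by rw [SimpleGraph.dist_comm]; omega
    rw [← fderiv_comp_add_right]
    congr 2
    funext Z
    exact hinv i v h3 Z s α
end OSQ
end
end
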